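/- For all integers n ≥ 0 and ℓ ≥ 0, and every complex q with 0 < |q| < 1, ∑_{j=0}^{n} (-1;q)_j (-1)^j q^{-j(n+ℓ)} / (q;q)_j = (-1)^ℓ · [ (q^{n+1};q)_ℓ / (-q^{n+1};q)_ℓ ] · ∑_{j=0}^{n+ℓ} (-1;q)_j (-1)^j q^{-jn} / (q;q)_j. -/

import Mathlib

open scoped BigOperators

/-- The finite q-Pochhammer symbol `(a;q)_n`. -/
noncomputable def qPoch (a q : ℂ) (n : ℕ) : ℂ := ∏ k ∈ Finset.range n, (1 - a * q ^ k)

theorem qPoch_add (a q : ℂ) (m n : ℕ) :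
    qPoch a q (m + n) = qPoch a q m * qPoch (a * q ^ m) q n := by
  simp only [qPoch, Finset.prod_range_add, pow_add, mul_assoc]

theorem qPoch_succ (a q : ℂ) (n : ℕ) : qPoch a q (n + 1) = qPoch a q n * (1 - a * q ^ n) :=
  Finset.prod_range_succ _ _

theorem qPoch_ne_zero {a q : ℂ} (ha : ‖a‖ < 1) (hq : ‖q‖ < 1) (n : ℕ) : qPoch a q n ≠ 0 := by
  refine Finset.prod_ne_zero_iff.2 fun k _ h => ?_
  have h1 : ‖a * q ^ k‖ < 1 := by
    rw [norm_mul, norm_pow]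
    exact (mul_le_of_le_one_right (norm_nonneg a)
      (pow_le_one₀ (norm_nonneg q) hq.le)).trans_lt ha
  rw [← sub_eq_zero.1 h, norm_one] at h1
  exact lt_irrefl _ h1

theorem qPoch_neg_one_mul (q : ℂ) (n : ℕ) :
    qPoch (-1) q n * (1 + q ^ n) = 2 * qPoch (-q) q n := by
  have h := qPoch_add (-1) q 1 n
  rw [add_comm 1 n, qPoch_succ] at h
  have h1 : qPoch (-1) q 1 = 2 := by norm_num [qPoch]
  rw [h1] at h
  simpa using h

theorem one_add_pow_ne_zero {q : ℂ} (hq : ‖q‖ < 1) (n : ℕ) : 1 + q ^ n ≠ 0 := by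
  rcases n with _ | n
  · norm_num
  · intro h
    have h1 : ‖q ^ (n + 1)‖ < 1 := by
      rw [norm_pow]
      exact pow_lt_one₀ (norm_nonneg q) hq n.succ_ne_zero
    rw [eq_neg_of_add_eq_zero_right h, norm_neg, norm_one] at h1
    exact lt_irrefl _ h1

/-- The symmetry in `n` and `m` of `a m * ∑ j ≤ n, 2 * a j * q ^ (-j * m) / (1 + q ^ j)`, for a
sequence `a` with `a (n + 1) = -a n * (1 + q ^ (n + 1)) / (1 - q ^ (n + 1))`. -/
theorem mul_sum_symm {q : ℂ} (hq : q ≠ 0) (hp : ∀ n : ℕ, 1 + q ^ n ≠ 0) {a : ℕ → ℂ}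
    (a_zero : a 0 = 1)
    (a_succ : ∀ n, a (n + 1) * (1 - q ^ (n + 1)) = -(a n * (1 + q ^ (n + 1)))) (n m : ℕ) :
    a m * ∑ j ∈ Finset.range (n + 1), 2 * a j / (1 + q ^ j) * q⁻¹ ^ (j * m) =
      a n * ∑ j ∈ Finset.range (m + 1), 2 * a j / (1 + q ^ j) * q⁻¹ ^ (j * n) := by
  have a_eq (n : ℕ) : a n = -(a (n + 1) * (1 - q ^ (n + 1)) / (1 + q ^ (n + 1))) := by
    rw [a_succ, neg_div, neg_neg, mul_div_cancel_right₀ _ (hp _)]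
  have boundary (n : ℕ) : ∑ j ∈ Finset.range (n + 1), 2 * a j / (1 + q ^ j) = a n := by
    induction n with
    | zero => norm_num [a_zero]
    | succ n ih =>
      rw [Finset.sum_range_succ, ih, a_eq n]
      have := hp (n + 1)
      field_simp
      ring
  induction n generalizing m with
  | zero =>
    simp only [mul_zero, pow_zero, mul_one, boundary]
    norm_num [a_zero]
  | succ n ihn =>
    induction m with
    | zero =>
      simp only [mul_zero, pow_zero, mul_one, boundary]
      norm_num [a_zero]
    | succ m ihm =>
      have h₁ := ihn m
      have h₂ := ihn (m + 1)
      rw [Finset.sum_range_succ _ (n + 1)] at ihm ⊢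
      rw [Finset.sum_range_succ _ (m + 1)] at h₂ ⊢
      have key : a n * (2 * a (m + 1) / (1 + q ^ (m + 1)) * q⁻¹ ^ ((m + 1) * n)) +
            a (m + 1) * (2 * a (n + 1) / (1 + q ^ (n + 1)) * q⁻¹ ^ ((n + 1) * (m + 1))) =
          a m * (2 * a (n + 1) / (1 + q ^ (n + 1)) * q⁻¹ ^ ((n + 1) * m)) +
            a (n + 1) * (2 * a (m + 1) / (1 + q ^ (m + 1)) * q⁻¹ ^ ((m + 1) * (n + 1))) := by
        have e₁ : q⁻¹ ^ ((m + 1) * n) = q⁻¹ ^ ((m + 1) * (n + 1)) * q ^ (m + 1) := by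
          rw [mul_add_one, pow_add, mul_assoc, ← mul_pow, inv_mul_cancel₀ hq, one_pow, mul_one]
        have e₂ : q⁻¹ ^ ((n + 1) * m) = q⁻¹ ^ ((m + 1) * (n + 1)) * q ^ (n + 1) := by
          rw [mul_comm (m + 1), mul_add_one (n + 1), pow_add, mul_assoc, ← mul_pow,
            inv_mul_cancel₀ hq, one_pow, mul_one]
        rw [e₁, e₂, mul_comm (n + 1) (m + 1), a_eq n, a_eq m]
        have hn := hp (n + 1)
        have hm := hp (m + 1)
        generalize q⁻¹ ^ ((m + 1) * (n + 1)) = z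
        generalize q ^ (n + 1) = x at *
        generalize q ^ (m + 1) = y at *
        field_simp
        ring
      linear_combination ihm + h₂ - h₁ + key

theorem finite_fine_identity_general (n ℓ : ℕ) (q : ℂ) (hq0 : 0 < ‖q‖) (hq1 : ‖q‖ < 1) :
    ∑ j ∈ Finset.range (n + 1),
        qPoch (-1) q j * (-1) ^ j * q ^ (-((j : ℤ) * ((n : ℤ) + (ℓ : ℤ)))) / qPoch q q j
      = (-1 : ℂ) ^ ℓ * (qPoch (q ^ (n + 1)) q ℓ / qPoch (-(q ^ (n + 1))) q ℓ) *
          ∑ j ∈ Finset.range (n + ℓ + 1),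
            qPoch (-1) q j * (-1) ^ j * q ^ (-((j : ℤ) * (n : ℤ))) / qPoch q q j := by
  have hq : q ≠ 0 := norm_pos_iff.1 hq0
  have hp := one_add_pow_ne_zero hq1
  have hP := qPoch_ne_zero hq1 hq1
  have hN := qPoch_ne_zero (a := -q) (by rwa [norm_neg]) hq1
  have hx : ‖q ^ (n + 1)‖ < 1 := by
    rw [norm_pow]
    exact pow_lt_one₀ hq0.le hq1 n.succ_ne_zero
  have hPl := qPoch_ne_zero hx hq1 ℓ
  have hNl := qPoch_ne_zero (a := -(q ^ (n + 1))) (by rwa [norm_neg]) hq1 ℓ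
  have term (j m : ℕ) :
      qPoch (-1) q j * (-1) ^ j * q ^ (-((j : ℤ) * (m : ℤ))) / qPoch q q j =
        2 * ((-1) ^ j * qPoch (-q) q j / qPoch q q j) / (1 + q ^ j) * q⁻¹ ^ (j * m) := by
    have e : q ^ (-((j : ℤ) * (m : ℤ))) = q⁻¹ ^ (j * m) := by
      rw [zpow_neg, ← Nat.cast_mul, zpow_natCast, inv_pow]
    rw [e, eq_div_of_mul_eq (hp j) (qPoch_neg_one_mul q j)]
    ring
  have symm := mul_sum_symm hq hp (a := fun j => (-1) ^ j * qPoch (-q) q j / qPoch q q j)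
    (by simp [qPoch])
    (fun k => by
      have hk := hP k
      have hk' := hP (k + 1)
      rw [qPoch_succ] at hk'
      have hk'' := right_ne_zero_of_mul hk'
      simp only [qPoch_succ, ← pow_succ', neg_mul, sub_neg_eq_add] at hk'' ⊢
      field_simp
      ring) n (n + ℓ)
  simp only [← Nat.cast_add, term]
  have hPa : qPoch q q (n + ℓ) = qPoch q q n * qPoch (q ^ (n + 1)) q ℓ := by
    rw [qPoch_add, pow_succ']
  have hNa : qPoch (-q) q (n + ℓ) = qPoch (-q) q n * qPoch (-(q ^ (n + 1))) q ℓ := by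
    rw [qPoch_add, pow_succ', neg_mul]
  rw [hPa, hNa] at symm
  have hPn := hP n
  have hNn := hN n
  generalize Finset.sum (Finset.range (n + 1)) (_ : ℕ → ℂ) = S at symm ⊢
  generalize Finset.sum (Finset.range (n + ℓ + 1)) (_ : ℕ → ℂ) = T at symm ⊢
  have hs : ((-1 : ℂ) ^ ℓ) * (-1) ^ ℓ = 1 := by rw [← mul_pow]; norm_num
  have hs' : (-1 : ℂ) ^ n ≠ 0 := by simp
  rw [pow_add] at symm
  field_simp at symm ⊢
  linear_combination (-1) ^ ℓ * symm - S * qPoch (-(q ^ (n + 1))) q ℓ * hs
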